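/- Let V be a 2-generated primitive axial algebra of Monster type (2β, β) over a field F of characteristic ≠ 2 (β ∉ {0, 1, 1/2}) with generating axes a₀, a₁. If the eight elements a₋₂, a₋₁, a₀, a₁, a₂, a₃, s₀,₁, s₀,₃ are linearly independent over F, then λ₁ = λ₁ᶠ and λ₂ = λ₂ᶠ. -/

import Mathlib

/-- The `δ`-eigenspace of the adjoint action of `a` on `V`. -/
def eigSp (F : Type*) [Field F] {V : Type*} [NonUnitalNonAssocCommRing V]
    [Module F V] [SMulCommClass F V V] [IsScalarTower F V V]
    (a : V) (δ : F) : Submodule F V where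
  carrier := {v | a * v = δ • v}
  add_mem' := by
    intro x y hx hy
    simp only [Set.mem_setOf_eq] at *
    rw [mul_add, hx, hy, smul_add]
  zero_mem' := by
    simp
  smul_mem' := by
    intro c x hx
    simp only [Set.mem_setOf_eq] at *
    rw [mul_smul_comm, hx, smul_comm]

/-- `τ` is the Miyamoto involution associated with the axis `a`:  it is the identity on the
`1`-, `0`- and `α`-eigenspaces of `ad a` and `-1` on the `β`-eigenspace. -/
def IsMiyamoto (F : Type*) [Field F] {V : Type*} [NonUnitalNonAssocCommRing V]
    [Module F V] [SMulCommClass F V V] [IsScalarTower F V V]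
    (α β : F) (a : V) (τ : V ≃ₗ[F] V) : Prop :=
  (∀ v ∈ eigSp F a 1, τ v = v) ∧ (∀ v ∈ eigSp F a 0, τ v = v) ∧
    (∀ v ∈ eigSp F a α, τ v = v) ∧ (∀ v ∈ eigSp F a β, τ v = -v)

/-- `a` is a primitive axis of Monster type `(α, β)`:  `a` is idempotent, `V` decomposes as the
sum of the eigenspaces of `ad a` for the eigenvalues `1, 0, α, β`, the fusion law
M(α, β) holds, and the `1`-eigenspace is spanned by `a` (primitivity). -/
structure IsAxis (F : Type*) [Field F] {V : Type*} [NonUnitalNonAssocCommRing V]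
    [Module F V] [SMulCommClass F V V] [IsScalarTower F V V]
    (α β : F) (a : V) : Prop where
  idem : a * a = a
  semisimple : eigSp F a 1 ⊔ eigSp F a 0 ⊔ eigSp F a α ⊔ eigSp F a β = ⊤
  primitive : eigSp F a 1 = Submodule.span F {a}
  fusion11 : ∀ u ∈ eigSp F a 1, ∀ v ∈ eigSp F a 1, u * v ∈ eigSp F a 1
  fusion10 : ∀ u ∈ eigSp F a 1, ∀ v ∈ eigSp F a 0, u * v = 0
  fusion1a : ∀ u ∈ eigSp F a 1, ∀ v ∈ eigSp F a α, u * v ∈ eigSp F a α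
  fusion1b : ∀ u ∈ eigSp F a 1, ∀ v ∈ eigSp F a β, u * v ∈ eigSp F a β
  fusion00 : ∀ u ∈ eigSp F a 0, ∀ v ∈ eigSp F a 0, u * v ∈ eigSp F a 0
  fusion0a : ∀ u ∈ eigSp F a 0, ∀ v ∈ eigSp F a α, u * v ∈ eigSp F a α
  fusion0b : ∀ u ∈ eigSp F a 0, ∀ v ∈ eigSp F a β, u * v ∈ eigSp F a β
  fusionaa : ∀ u ∈ eigSp F a α, ∀ v ∈ eigSp F a α, u * v ∈ eigSp F a 1 ⊔ eigSp F a 0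
  fusionab : ∀ u ∈ eigSp F a α, ∀ v ∈ eigSp F a β, u * v ∈ eigSp F a β
  fusionbb : ∀ u ∈ eigSp F a β, ∀ v ∈ eigSp F a β,
    u * v ∈ eigSp F a 1 ⊔ eigSp F a 0 ⊔ eigSp F a α

/-- The sequence of axes `a i` (`i ∈ ℤ`) generated from `a₀`, `a₁` by the Miyamoto
involutions:  with `σ = τ₁ ∘ τ₀`, `a (2*i) = σ^i a₀` and `a (2*i+1) = σ^i a₁`. -/
noncomputable def aSeq {F : Type*} [Field F] {V : Type*} [NonUnitalNonAssocCommRing V]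
    [Module F V] [SMulCommClass F V V] [IsScalarTower F V V]
    (a₀ a₁ : V) (τ₀ τ₁ : V ≃ₗ[F] V) (i : ℤ) : V :=
  if i % 2 = 0 then ((τ₁ * τ₀) ^ (i / 2)) a₀ else ((τ₁ * τ₀) ^ ((i - 1) / 2)) a₁

/-- `s r n = a r * a (r+n) - β • (a r + a (r+n))`. -/
noncomputable def sSeq {F : Type*} [Field F] {V : Type*} [NonUnitalNonAssocCommRing V]
    [Module F V] [SMulCommClass F V V] [IsScalarTower F V V]
    (β : F) (a₀ a₁ : V) (τ₀ τ₁ : V ≃ₗ[F] V) (r n : ℤ) : V :=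
  aSeq a₀ a₁ τ₀ τ₁ r * aSeq a₀ a₁ τ₀ τ₁ (r + n)
    - β • (aSeq a₀ a₁ τ₀ τ₁ r + aSeq a₀ a₁ τ₀ τ₁ (r + n))

section MonsterType

variable {F V : Type*} [Field F] [NonUnitalNonAssocCommRing V] [Module F V]
  [SMulCommClass F V V] [IsScalarTower F V V]

theorem mem_eigSp {a v : V} {δ : F} : v ∈ eigSp F a δ ↔ a * v = δ • v := Iff.rfl

/-- `y` and `y'` have eigenvalue-`1` component `l • e` for the axis `e`, and `y'` is the image of
`y` under the Miyamoto involution of `e`. -/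
def IsReflected (β : F) (e y y' : V) (l : F) : Prop :=
  ∃ u v w : V, e * u = 0 ∧ e * v = (2 * β) • v ∧ e * w = β • w ∧
    y = l • e + u + v + w ∧ y' = l • e + u + v - w

omit [SMulCommClass F V V] [IsScalarTower F V V] in
theorem IsReflected.symm {β : F} {e y y' : V} {l : F} (hr : IsReflected β e y y' l) :
    IsReflected β e y' y l := by
  obtain ⟨u, v, w, hu, hv, hw, rfl, rfl⟩ := hr
  exact ⟨u, v, -w, hu, hv, by rw [mul_neg, hw, smul_neg], by abel, by abel⟩

/-- The sum of the eigenspaces of `e` complementary to the `1`-eigenspace. -/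
def complSp (β : F) (e : V) : Submodule F V :=
  eigSp F e 0 ⊔ eigSp F e (2 * β) ⊔ eigSp F e β

theorem mem_complSp {β : F} {e x : V} :
    x ∈ complSp β e ↔ ∃ u v w : V, e * u = 0 ∧ e * v = (2 * β) • v ∧ e * w = β • w ∧
      x = u + v + w := by
  simp only [complSp, Submodule.mem_sup, mem_eigSp, zero_smul]
  constructor
  · rintro ⟨_, ⟨u, hu, v, hv, rfl⟩, w, hw, rfl⟩
    exact ⟨u, v, w, hu, hv, hw, rfl⟩
  · rintro ⟨u, v, w, hu, hv, hw, rfl⟩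
    exact ⟨_, ⟨u, hu, v, hv, rfl⟩, w, hw, rfl⟩

theorem IsReflected.sub_smul_mem {β : F} {e y y' : V} {l : F} (hr : IsReflected β e y y' l) :
    y - l • e ∈ complSp β e := by
  obtain ⟨u, v, w, hu, hv, hw, rfl, rfl⟩ := hr
  exact mem_complSp.2 ⟨u, v, w, hu, hv, hw, by abel⟩

theorem smul_axis_eq_zero {β : F} (h0 : β ≠ 0) (h1 : β ≠ 1) (hhalf : 2 * β ≠ 1) {e : V}
    (he : e * e = e) {k : F} (hk : k • e ∈ complSp β e) : k • e = 0 := by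
  obtain ⟨u, v, w, hu, hv, hw, hx⟩ := mem_complSp.1 hk
  have e1 : k • e = (2 * β) • v + β • w := by
    have := congrArg (e * ·) hx
    simpa only [mul_smul_comm, he, mul_add, hu, hv, hw, zero_add] using this
  have e2 : k • e = (2 * β) • (2 * β) • v + β • β • w := by
    have := congrArg (e * ·) e1
    simpa only [mul_smul_comm, he, mul_add, hu, hv, hw, zero_add] using this
  have e3 : k • e = (2 * β) • (2 * β) • (2 * β) • v + β • β • β • w := by
    have := congrArg (e * ·) e2
    simpa only [mul_smul_comm, he, mul_add, hu, hv, hw, zero_add] using this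
  have hv0 : (2 * β * β * (1 - 2 * β)) • v = 0 := by
    linear_combination (norm := module) β • e1 + e3 - (1 + β) • e2
  have hw0 : (β * β * (1 - β)) • w = 0 := by
    linear_combination (norm := module) (1 + 2 * β) • e2 - (2 * β) • e1 - e3
  have h2v : (2 * β) • v = 0 := by
    have hne : β * (1 - 2 * β) ≠ 0 := mul_ne_zero h0 (sub_ne_zero.2 hhalf.symm)
    refine (smul_eq_zero_iff_right hne).1 ?_
    linear_combination (norm := module) hv0
  have hbw : β • w = 0 := by
    have hne : β * (1 - β) ≠ 0 := mul_ne_zero h0 (sub_ne_zero.2 h1.symm)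
    refine (smul_eq_zero_iff_right hne).1 ?_
    linear_combination (norm := module) hw0
  rw [e1, h2v, hbw, add_zero]

omit [IsScalarTower F V V] in
/-- The Miyamoto involution of `e` fixes `s = e * y - 2 * h • (e + y)`. -/
theorem IsReflected.axis_mul_swap {h : F} {e y y' s : V} {l : F} (he : e * e = e)
    (hr : IsReflected (2 * h) e y y' l) (hs : e * y = s + (2 * h) • (e + y)) :
    e * y' = s + (2 * h) • (e + y') := by
  obtain ⟨u, v, w, hu, hv, hw, rfl, rfl⟩ := hr
  simp only [mul_add, mul_sub, mul_smul_comm, he, hu, hv, hw] at hs ⊢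
  linear_combination (norm := module) hs

omit [IsScalarTower F V V] in
theorem IsReflected.axis_mul_s {h : F} {e y y' s : V} {l : F} (he : e * e = e)
    (hr : IsReflected (2 * h) e y y' l) (hs : e * y = s + (2 * h) • (e + y)) :
    e * s = (2 * h) • s + ((1 - 4 * h) * l + 2 * h * (2 * h - 1)) • e
      + (2 * h * h) • (y + y') := by
  obtain ⟨u, v, w, hu, hv, hw, rfl, rfl⟩ := hr
  have hs' : s = e * (l • e + u + v + w) - (2 * h) • (e + (l • e + u + v + w)) := by
    rw [hs, add_sub_cancel_right]
  subst hs'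
  simp only [mul_add, mul_sub, mul_smul_comm, he, hu, hv, hw, mul_zero]
  module

/-- Resurrection: `u ^ 2 - v ^ 2` is annihilated by `e` up to a multiple of `e`, where `u` and `v`
are the `0`- and `4 * h`-components of `y`. -/
theorem IsReflected.resurrection {h : F} {e y y' s : V} {l : F}
    (ha : IsAxis F (2 * (2 * h)) (2 * h) e)
    (hr : IsReflected (2 * h) e y y' l) (hs : e * y = s + (2 * h) • (e + y)) (c : F)
    (hc : c = (1 - 2 * h) * l - 2 * h) (P Q : V) (hP : P = y + y' - (2 * l) • e)
    (hQ : Q = c • e - s) :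
    ∃ k : F, e * (Q * P) = k • e ∧ Q * P - k • e ∈ complSp (2 * h) e ∧
      (4 : F) • (Q * Q) = (4 * h * h) • (P * P) - (2 * h) • (e * (P * P)) - (2 * k) • e := by
  have he := ha.idem
  obtain ⟨u, v, w, hu, hv, hw, rfl, rfl⟩ := hr
  have hs' : s = e * (l • e + u + v + w) - (2 * h) • (e + (l • e + u + v + w)) := by
    rw [hs, add_sub_cancel_right]
  have hP' : P = (2 : F) • (u + v) := by rw [hP]; module
  have hQ' : Q = (2 * h) • (u - v) := by
    rw [hQ, hs', hc]
    simp only [mul_add, mul_smul_comm, he, hu, hv, hw]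
    module
  have huu : e * (u * u) = 0 := by
    have := ha.fusion00 u (by simpa [mem_eigSp] using hu) u (by simpa [mem_eigSp] using hu)
    simpa [mem_eigSp] using this
  have huv : e * (u * v) = (2 * (2 * h)) • (u * v) :=
    ha.fusion0a u (by simpa [mem_eigSp] using hu) v hv
  obtain ⟨x, hx, z, hz, hxz⟩ := Submodule.mem_sup.1 (ha.fusionaa v hv v hv)
  rw [ha.primitive] at hx
  obtain ⟨k, rfl⟩ := Submodule.mem_span_singleton.1 hx
  rw [mem_eigSp, zero_smul] at hz
  have hvv : e * (v * v) = k • e := by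
    rw [← hxz, mul_add, hz, mul_smul_comm, he, add_zero]
  have hQP : Q * P = (4 * h) • (u * u) - (4 * h) • (v * v) := by
    rw [hQ', hP']
    simp only [mul_add, sub_mul, mul_smul_comm, smul_mul_assoc, mul_comm v u]
    module
  have hPP : P * P = (4 : F) • (u * u) + (8 : F) • (u * v) + (4 : F) • (v * v) := by
    rw [hP']
    simp only [mul_add, add_mul, mul_smul_comm, smul_mul_assoc, mul_comm v u]
    module
  have hQQ : Q * Q = (4 * h * h) • (u * u) - (8 * h * h) • (u * v) + (4 * h * h) • (v * v) := by
    rw [hQ']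
    simp only [mul_sub, sub_mul, mul_smul_comm, smul_mul_assoc, mul_comm v u]
    module
  refine ⟨-(4 * h * k), ?_, mem_complSp.2 ⟨(4 * h) • (u * u) - (4 * h) • z, 0, 0, ?_, ?_, ?_, ?_⟩,
    ?_⟩
  · rw [hQP, mul_sub, mul_smul_comm, mul_smul_comm, huu, hvv]
    module
  · rw [mul_sub, mul_smul_comm, mul_smul_comm, huu, hz]
    module
  · simp
  · simp
  · rw [hQP, ← hxz]
    module
  · rw [hPP, hQQ]
    simp only [mul_add, mul_smul_comm, huu, huv, hvv]
    module

/-- At an axis `e` with neighbours `p1, n1` and second neighbours `p2, n2`, the product `e * p2` is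
a linear combination of `e, p1 + n1, p2 + n2` and `s`. -/
theorem IsReflected.axis_mul_second {h : F} (h2 : (2 : F) ≠ 0) (h0 : h ≠ 0) (h1 : 2 * h ≠ 1)
    (h4 : 4 * h ≠ 1) {e p1 n1 p2 n2 s : V} {l m l2 : F}
    (ha : IsAxis F (2 * (2 * h)) (2 * h) e) (r1 : IsReflected (2 * h) e p1 n1 l)
    (r2 : IsReflected (2 * h) e p2 n2 l2) (hs : e * p1 = s + (2 * h) • (e + p1))
    (hp : p1 * s = (2 * h) • s + ((1 - 4 * h) * m + 2 * h * (2 * h - 1)) • p1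
      + (2 * h * h) • (p2 + e))
    (hn : n1 * s = (2 * h) • s + ((1 - 4 * h) * m + 2 * h * (2 * h - 1)) • n1
      + (2 * h * h) • (e + n2))
    {c D K A B C : F} (hc : c = (1 - 2 * h) * l - 2 * h)
    (hA : A = 4 * h * c - 2 * l * c - 4 * h * h + 2 * l * ((1 - 4 * h) * l + 2 * h * (2 * h - 1)))
    (hB : B = 2 * h * c - ((1 - 4 * h) * m + 2 * h * (2 * h - 1)) + 4 * l * h * h)
    (hC : C = 2 * c - 4 * h + 4 * l * h)
    (hD : 2 * h * h * D = B + h * C)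
    (hK : 4 * h * h * K = 4 * h * B + ((1 - 4 * h) * l + 2 * h * (2 * h - 1)) * C - 8 * h ^ 3
      - (2 * l * B + c * C - 4 * h * h * l2)) :
    e * p2 = K • e + (h * D) • (p1 + n1) + D • s - h • (p2 + n2) + (2 * h) • (e + p2) ∧
    ∀ P Q : V, P = p1 + n1 - (2 * l) • e → Q = c • e - s →
      (4 : F) • (Q * Q) = (4 * h * h) • (P * P) - (2 * h) • (e * (P * P))
        - (2 * (A + 2 * l * B + c * C - 4 * h * h * l2)) • e := by
  have he := ha.idem
  have hs' := r1.axis_mul_swap he hs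
  have hes := r1.axis_mul_s he hs
  have hpe : p1 * e = _ := (mul_comm _ _).trans hs
  have hne : n1 * e = _ := (mul_comm _ _).trans hs'
  obtain ⟨k, hk, hk', hk4⟩ := r1.resurrection ha hs c hc _ _ rfl rfl
  have hQP : (c • e - s) * (p1 + n1 - (2 * l) • e) = A • e + B • (p1 + n1) + C • s
      - (2 * h * h) • (p2 + n2) := by
    have e1 : (c • e - s) * (p1 + n1 - (2 * l) • e) = c • (e * p1) + c • (e * n1)
        - (2 * l * c) • (e * e) - p1 * s - n1 * s + (2 * l) • (e * s) := by
      simp only [mul_add, mul_sub, sub_mul, mul_smul_comm, smul_mul_assoc, mul_comm s]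
      module
    rw [e1, hs, hs', he, hp, hn, hes, hA, hB, hC]
    module
  have hsc : s - c • e ∈ complSp (2 * h) e := by
    obtain ⟨u, v, w, hu, hv, hw, rfl, rfl⟩ := r1
    refine mem_complSp.2 ⟨-((2 * h) • u), (2 * h) • v, 0, ?_, ?_, ?_, ?_⟩
    · rw [mul_neg, mul_smul_comm, hu, smul_zero, neg_zero]
    · rw [mul_smul_comm, hv, smul_comm]
    · simp
    · have : s = e * (l • e + u + v + w) - (2 * h) • (e + (l • e + u + v + w)) := by
        rw [hs, add_sub_cancel_right]
      rw [this, hc]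
      simp only [mul_add, mul_smul_comm, he, hu, hv, hw]
      module
  have hkk : (A + 2 * l * B + c * C - 4 * h * h * l2 - k) • e = 0 := by
    refine smul_axis_eq_zero (β := 2 * h) (mul_ne_zero h2 h0) h1
      (by ring_nf; simpa [mul_comm] using h4) he ?_
    rw [hQP] at hk'
    have m1 := (complSp (2 * h) e).smul_mem B (add_mem r1.sub_smul_mem r1.symm.sub_smul_mem)
    have m2 := (complSp (2 * h) e).smul_mem (2 * h * h) (add_mem r2.sub_smul_mem r2.symm.sub_smul_mem)
    have m3 := (complSp (2 * h) e).smul_mem C hsc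
    have := add_mem (sub_mem (sub_mem hk' m1) m3) m2
    convert this using 1
    module
  have hke : k • e = (A + 2 * l * B + c * C - 4 * h * h * l2) • e := by
    rw [sub_smul, sub_eq_zero] at hkk
    exact hkk.symm
  constructor
  · rw [hQP, hke] at hk
    have hx : e * n2 = e * p2 - (2 * h) • (p2 - n2) := by
      have := r2.axis_mul_swap (s := e * p2 - (2 * h) • (e + p2)) he (sub_add_cancel _ _).symm
      rw [this]; module
    have hne' : 4 * h * h ≠ 0 := by
      have : (4 : F) ≠ 0 := by
        rw [show (4 : F) = 2 * 2 by norm_num]; exact mul_ne_zero h2 h2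
      exact mul_ne_zero (mul_ne_zero this h0) h0
    refine smul_right_injective V hne' ?_
    simp only [mul_add, mul_sub, mul_smul_comm, he, hs, hs', hes, hx] at hk ⊢
    linear_combination (norm := module) -hk - hK • e - (2 * h) • hD • (p1 + n1)
      - (2 : F) • hD • s
  · rintro P Q rfl rfl
    rw [hk4]
    linear_combination (norm := module) (-2 : F) • hke

/-- The square of `s` computed at the axis `e`. -/
theorem axis_sq_s {h : F} {e p1 n1 p2 n2 p3 n3 s r : V} {l c k D K D' K' : F}
    (he : e * e = e) (hsp : e * p1 = s + (2 * h) • (e + p1))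
    (hsn : e * n1 = s + (2 * h) • (e + n1)) (hp1 : p1 * p1 = p1) (hn1 : n1 * n1 = n1)
    (hes : e * s = (2 * h) • s + ((1 - 4 * h) * l + 2 * h * (2 * h - 1)) • e
      + (2 * h * h) • (p1 + n1))
    (hp2 : e * p2 = K • e + (h * D) • (p1 + n1) + D • s - h • (p2 + n2) + (2 * h) • (e + p2))
    (hn2 : e * n2 = K • e + (h * D) • (p1 + n1) + D • s - h • (p2 + n2) + (2 * h) • (e + n2))
    (hp3 : e * p3 = r + (2 * h) • (e + p3)) (hn3 : e * n3 = r + (2 * h) • (e + n3))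
    (hpn : (2 : F) • (p1 * n1) = (K' + 3 * h) • (p1 + n1) + (h * D') • ((2 : F) • e + p2 + n2)
      + (2 * D') • s - h • (p3 + n3))
    (hsq : ∀ P Q : V, P = p1 + n1 - (2 * l) • e → Q = c • e - s →
      (4 : F) • (Q * Q) = (4 * h * h) • (P * P) - (2 * h) • (e * (P * P)) - (2 * k) • e)
    {N1 Ne Ns : F} (hN1 : N1 = 1 + K' + 3 * h - 8 * l * h)
    (hNe : Ne = 2 * h * D' - 16 * l * h + 4 * l * l) (hNs : Ns = 2 * D' - 8 * l) :
    (4 : F) • (s * s) =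
      (8 * c * ((1 - 4 * h) * l + 2 * h * (2 * h - 1)) - 4 * c * c + 4 * h * h * Ne
        - 2 * h * (4 * h * N1 + 2 * h * D' * K + 4 * h * h * D' + Ne
          + ((1 - 4 * h) * l + 2 * h * (2 * h - 1)) * Ns - 4 * h * h) - 2 * k) • e
      + (16 * c * h * h - 4 * h ^ 3 * D * D' - 4 * h ^ 3 * Ns) • (p1 + n1)
      + (4 * h ^ 3 * D') • (p2 + n2)
      + (16 * h * c - 4 * h * N1 - 4 * h * h * D * D') • s
      + (4 * h * h) • r := by
  have hPP : (p1 + n1 - (2 * l) • e) * (p1 + n1 - (2 * l) • e) =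
      N1 • (p1 + n1) + (h * D') • (p2 + n2) + Ne • e + Ns • s - h • (p3 + n3) := by
    have e1 : (p1 + n1 - (2 * l) • e) * (p1 + n1 - (2 * l) • e) = p1 * p1 + n1 * n1
        + (2 : F) • (p1 * n1) - (4 * l) • (e * p1) - (4 * l) • (e * n1)
        + (4 * l * l) • (e * e) := by
      simp only [mul_add, add_mul, mul_sub, sub_mul, mul_smul_comm, smul_mul_assoc,
        mul_comm p1 e, mul_comm n1 e, mul_comm n1 p1]
      module
    rw [e1, hp1, hn1, hpn, hsp, hsn, he, hN1, hNe, hNs]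
    module
  have h4 := hsq _ _ rfl rfl
  rw [hPP] at h4
  have e2 : (c • e - s) * (c • e - s) = (c * c) • (e * e) - (2 * c) • (e * s) + s * s := by
    simp only [mul_sub, sub_mul, mul_smul_comm, smul_mul_assoc, mul_comm s e]
    module
  rw [e2] at h4
  simp only [mul_add, mul_sub, mul_smul_comm, he, hsp, hsn, hes, hp2, hn2, hp3, hn3] at h4
  linear_combination (norm := module) h4

/-- A sequence of axes of Monster type `(4 * h, 2 * h)`, each `a i` reflecting the sequence about
`i`, where `L i` and `M i` are the components of `a (i + 1)` and `a (i + 2)` along `a i`. -/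
structure IsAxisSeq (h : F) (a : ℤ → V) (L M : ℤ → F) : Prop where
  axis : ∀ i, IsAxis F (2 * (2 * h)) (2 * h) (a i)
  refl_one : ∀ i, IsReflected (2 * h) (a i) (a (i + 1)) (a (i - 1)) (L i)
  refl_two : ∀ i, IsReflected (2 * h) (a i) (a (i + 2)) (a (i - 2)) (M i)
  refl_three : ∀ i, ∃ l, IsReflected (2 * h) (a i) (a (i + 3)) (a (i - 3)) l
  period : ∀ i, L (i + 2) = L i
  period' : ∀ i, M (i + 2) = M i

/-- The structure constants occurring in products at an axis `e = a i`, where `l, m, l2` are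
`L i, L (i + 1), M i`. -/
structure IsCoeff (h l m l2 c A B C D K : F) : Prop where
  c_eq : c = (1 - 2 * h) * l - 2 * h
  A_eq : A = 4 * h * c - 2 * l * c - 4 * h * h
    + 2 * l * ((1 - 4 * h) * l + 2 * h * (2 * h - 1))
  B_eq : B = 2 * h * c - ((1 - 4 * h) * m + 2 * h * (2 * h - 1)) + 4 * l * h * h
  C_eq : C = 2 * c - 4 * h + 4 * l * h
  D_eq : 2 * h * h * D = B + h * C
  K_eq : 4 * h * h * K = 4 * h * B + ((1 - 4 * h) * l + 2 * h * (2 * h - 1)) * C - 8 * h ^ 3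
    - (2 * l * B + c * C - 4 * h * h * l2)

theorem exists_isCoeff {h : F} (h2 : (2 : F) ≠ 0) (h0 : h ≠ 0) (l m l2 : F) :
    ∃ c A B C D K, IsCoeff h l m l2 c A B C D K := by
  have h4 : (4 : F) ≠ 0 := by
    rw [show (4 : F) = 2 * 2 by norm_num]; exact mul_ne_zero h2 h2
  exact ⟨_, _, _, _, _, _, rfl, rfl, rfl, rfl,
    mul_div_cancel₀ _ (mul_ne_zero (mul_ne_zero h2 h0) h0),
    mul_div_cancel₀ _ (mul_ne_zero (mul_ne_zero h4 h0) h0)⟩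

/-- The equations between the structure constants resulting from `IsAxisSeq.relation` force the
two orbits of axes to have the same parameters. -/
theorem IsCoeff.eq_and_eq {h : F} (h2 : (2 : F) ≠ 0) (h0 : h ≠ 0) (h1 : 2 * h ≠ 1)
    (h4 : 4 * h ≠ 1) {c A B C D K c' A' B' C' D' K' l m l2 m2 : F}
    (hc : IsCoeff h l m l2 c A B C D K) (hc' : IsCoeff h m l m2 c' A' B' C' D' K')
    {N1 Ne Ns N1' Ne' Ns' T T' M₁ M₂ : F} (hN1 : N1 = 1 + K' + 3 * h - 8 * l * h)
    (hNe : Ne = 2 * h * D' - 16 * l * h + 4 * l * l) (hNs : Ns = 2 * D' - 8 * l)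
    (hN1' : N1' = 1 + K + 3 * h - 8 * m * h)
    (hNe' : Ne' = 2 * h * D - 16 * m * h + 4 * m * m) (hNs' : Ns' = 2 * D - 8 * m)
    (hT : T = 8 * c * ((1 - 4 * h) * l + 2 * h * (2 * h - 1)) - 4 * c * c + 4 * h * h * Ne
        - 2 * h * (4 * h * N1 + 2 * h * D' * K + 4 * h * h * D' + Ne
          + ((1 - 4 * h) * l + 2 * h * (2 * h - 1)) * Ns - 4 * h * h)
        - 2 * (A + 2 * l * B + c * C - 4 * h * h * l2))
    (hT' : T' = 8 * c' * ((1 - 4 * h) * m + 2 * h * (2 * h - 1)) - 4 * c' * c' + 4 * h * h * Ne'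
        - 2 * h * (4 * h * N1' + 2 * h * D * K' + 4 * h * h * D + Ne'
          + ((1 - 4 * h) * m + 2 * h * (2 * h - 1)) * Ns' - 4 * h * h)
        - 2 * (A' + 2 * m * B' + c' * C' - 4 * h * h * m2))
    (hM : M₁ = 16 * c' * h - 4 * h * h * Ns') (hM₂ : M₂ = 16 * c * h - 4 * h * h * Ns)
    (k1 : 4 * h ^ 3 * D' - h * M₁ = 0) (k2 : 4 * h ^ 3 * D - h * M₂ = 0)
    (k3 : T + M₁ * (K + h) + 4 * h ^ 3 * D * D' = 0)
    (k4 : -T' - M₁ * h * D - 4 * h ^ 2 * D * (K' + h) = 0)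
    (k5 : 16 * h * (c - c') - 4 * h * (N1 - N1') = 0) : l = m ∧ l2 = m2 := by
  obtain ⟨rfl, rfl, rfl, rfl, hD, hK⟩ := hc
  obtain ⟨rfl, rfl, rfl, rfl, hD', hK'⟩ := hc'
  subst hN1 hNe hNs hN1' hNe' hNs' hM hM₂
  have n4 : (4 : F) ≠ 0 := by
    rw [show (4 : F) = 2 * 2 by norm_num]; exact mul_ne_zero h2 h2
  have n8 : (8 : F) ≠ 0 := by
    rw [show (8 : F) = 2 * 4 by norm_num]; exact mul_ne_zero h2 n4
  have s1 : 12 * h * (l - m) + h * (l2 - m2) = 2 * (l - m) * (l + m) := by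
    refine mul_left_cancel₀ (mul_ne_zero n4 h0) ?_
    linear_combination h * k5 + hK' - hK
  have s2 : -32 * h ^ 2 + 12 * h * l + 4 * h * m + 6 * h - l - 2 * m = 0 := by
    refine mul_left_cancel₀ (mul_ne_zero h2 h0) ?_
    linear_combination k1 - 2 * h * hD' - 4 * h * hD
  have s3 : -32 * h ^ 2 + 12 * h * m + 4 * h * l + 6 * h - m - 2 * l = 0 := by
    refine mul_left_cancel₀ (mul_ne_zero h2 h0) ?_
    linear_combination k2 - 2 * h * hD - 4 * h * hD'
  have key : l = m := by
    by_contra hne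
    have h8 : h = -1 / 8 := by
      rw [eq_div_iff n8]
      refine mul_left_cancel₀ (sub_ne_zero.2 hne) ?_
      linear_combination s2 - s3
    have n3 : (3 : F) ≠ 0 := by
      intro n3
      refine h4 ?_
      rw [h8]
      field_simp
      linear_combination -4 * n3
    have n5 : (5 : F) ≠ 0 := by
      intro n5
      refine h1 ?_
      rw [h8]
      field_simp
      linear_combination -2 * n5
    subst h8
    have hm : m = -1 / 2 - l := by
      field_simp at s2 ⊢
      refine mul_left_cancel₀ (mul_ne_zero n5 (pow_ne_zero 4 h2)) ?_
      linear_combination -s2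
    subst hm
    have hm2 : m2 = l2 + 4 * (2 * l + 1 / 2) := by
      field_simp at s1 ⊢
      linear_combination s1
    subst hm2
    have hDv : D = 32 * l + 8 := by
      field_simp at hD ⊢
      refine mul_left_cancel₀ (pow_ne_zero 2 h2) ?_
      linear_combination hD
    have hDv' : D' = -(32 * l + 8) := by
      field_simp at hD' ⊢
      refine mul_left_cancel₀ (pow_ne_zero 2 h2) ?_
      linear_combination hD'
    have hKv : K = -32 * l ^ 2 - 16 * l + l2 - 7 / 4 := by
      field_simp at hK ⊢
      refine mul_left_cancel₀ (pow_ne_zero 4 h2) ?_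
      linear_combination hK
    have hKv' : K' = -32 * l ^ 2 - 8 * l + l2 + 1 / 4 := by
      field_simp at hK' ⊢
      refine mul_left_cancel₀ (pow_ne_zero 5 h2) ?_
      linear_combination hK'
    subst hDv hDv' hKv hKv' hT hT'
    refine hne ?_
    field_simp at k3 k4 ⊢
    refine mul_left_cancel₀ (mul_ne_zero (mul_ne_zero n3 n5) (pow_ne_zero 10 h2)) ?_
    linear_combination 2 * k3 + k4
  refine ⟨key, ?_⟩
  subst key
  refine mul_left_cancel₀ h0 ?_
  linear_combination s1

namespace IsAxisSeq

variable {h : F} {a : ℤ → V} {L M : ℤ → F}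

theorem flip (H : IsAxisSeq h a L M) :
    IsAxisSeq h (fun i => a (1 - i)) (fun i => L (1 - i)) (fun i => M (1 - i)) where
  axis i := H.axis _
  refl_one i := by
    have := (H.refl_one (1 - i)).symm
    convert this using 2 <;> ring
  refl_two i := by
    have := (H.refl_two (1 - i)).symm
    convert this using 2 <;> ring
  refl_three i := by
    obtain ⟨l, hl⟩ := H.refl_three (1 - i)
    refine ⟨l, ?_⟩
    convert hl.symm using 2 <;> ring
  period i := by
    have := H.period (1 - (i + 2))
    rw [← this]
    congr 1
    ring
  period' i := by
    have := H.period' (1 - (i + 2))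
    rw [← this]
    congr 1
    ring

/-- The common value of the elements `s i 1`. -/
def sOne (h : F) (a : ℤ → V) : V := a 0 * a 1 - (2 * h) • (a 0 + a 1)

theorem mul_succ (H : IsAxisSeq h a L M) (i : ℤ) :
    a i * a (i + 1) = sOne h a + (2 * h) • (a i + a (i + 1)) := by
  have step : ∀ j : ℤ, a (j - 1) * a j - (2 * h) • (a (j - 1) + a j) =
      a j * a (j + 1) - (2 * h) • (a j + a (j + 1)) := by
    intro j
    have := (H.refl_one j).axis_mul_swap (s := a j * a (j + 1) - (2 * h) • (a j + a (j + 1)))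
      (H.axis j).idem (sub_add_cancel _ _).symm
    rw [mul_comm, this]
    module
  suffices hs : a i * a (i + 1) - (2 * h) • (a i + a (i + 1)) = sOne h a by
    rw [← hs, sub_add_cancel]
  induction i using Int.induction_on with
  | zero => simp [sOne]
  | succ j ih => rw [← ih, ← step (j + 1), add_sub_cancel_right]
  | pred j ih => rw [← ih, ← step (-j), sub_add_cancel]

theorem mul_pred (H : IsAxisSeq h a L M) (i : ℤ) :
    a i * a (i - 1) = sOne h a + (2 * h) • (a i + a (i - 1)) :=
  (H.refl_one i).axis_mul_swap (H.axis i).idem (H.mul_succ i)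

theorem mul_sOne (H : IsAxisSeq h a L M) (i : ℤ) :
    a i * sOne h a = (2 * h) • sOne h a + ((1 - 4 * h) * L i + 2 * h * (2 * h - 1)) • a i
      + (2 * h * h) • (a (i + 1) + a (i - 1)) :=
  (H.refl_one i).axis_mul_s (H.axis i).idem (H.mul_succ i)

theorem mul_second (H : IsAxisSeq h a L M) (h2 : (2 : F) ≠ 0) (h0 : h ≠ 0) (h1 : 2 * h ≠ 1)
    (h4 : 4 * h ≠ 1) (i : ℤ) {c A B C D K : F}
    (hc : IsCoeff h (L i) (L (i + 1)) (M i) c A B C D K) :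
    a i * a (i + 2) = K • a i + (h * D) • (a (i + 1) + a (i - 1)) + D • sOne h a
      - h • (a (i + 2) + a (i - 2)) + (2 * h) • (a i + a (i + 2)) ∧
    ∀ P Q : V, P = a (i + 1) + a (i - 1) - (2 * L i) • a i → Q = c • a i - sOne h a →
      (4 : F) • (Q * Q) = (4 * h * h) • (P * P) - (2 * h) • (a i * (P * P))
        - (2 * (A + 2 * L i * B + c * C - 4 * h * h * M i)) • a i := by
  have hL : L (i - 1) = L (i + 1) := by rw [← H.period (i - 1)]; congr 1; ring
  refine (H.refl_one i).axis_mul_second h2 h0 h1 h4 (H.axis i) (H.refl_two i) (H.mul_succ i)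
    (m := L (i + 1)) ?_ ?_ hc.c_eq hc.A_eq hc.B_eq hc.C_eq hc.D_eq hc.K_eq
  · convert H.mul_sOne (i + 1) using 4 <;> ring_nf
  · convert H.mul_sOne (i - 1) using 4
    · rw [hL]
    · ring_nf
    · ring_nf

theorem mul_neg_second (H : IsAxisSeq h a L M) (h2 : (2 : F) ≠ 0) (h0 : h ≠ 0) (h1 : 2 * h ≠ 1)
    (h4 : 4 * h ≠ 1) (i : ℤ) {c A B C D K : F}
    (hc : IsCoeff h (L i) (L (i + 1)) (M i) c A B C D K) :
    a i * a (i - 2) = K • a i + (h * D) • (a (i + 1) + a (i - 1)) + D • sOne h a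
      - h • (a (i + 2) + a (i - 2)) + (2 * h) • (a i + a (i - 2)) :=
  (H.refl_two i).axis_mul_swap (H.axis i).idem (H.mul_second h2 h0 h1 h4 i hc).1

/-- The element `a i * a (i + 2)` can be computed both at `a i` and at `a (i + 2)`. -/
theorem recurrence (H : IsAxisSeq h a L M) (h2 : (2 : F) ≠ 0) (h0 : h ≠ 0) (h1 : 2 * h ≠ 1)
    (h4 : 4 * h ≠ 1) (i : ℤ) {c A B C D K : F}
    (hc : IsCoeff h (L i) (L (i + 1)) (M i) c A B C D K) :
    h • (a (i - 2) - a (i + 4)) =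
      (K + h) • (a i - a (i + 2)) + (h * D) • (a (i - 1) - a (i + 3)) := by
  have e1 := (H.mul_second h2 h0 h1 h4 i hc).1
  rw [← H.period i, ← H.period' i, ← H.period (i + 1),
    show i + 1 + 2 = i + 2 + 1 by ring] at hc
  have e2 := H.mul_neg_second h2 h0 h1 h4 (i + 2) hc
  rw [mul_comm, show i + 2 - 2 = i by ring, show i + 2 + 1 = i + 3 by ring,
    show i + 2 - 1 = i + 1 by ring, show i + 2 + 2 = i + 4 by ring] at e2
  linear_combination (norm := module) e1 - e2

theorem sq_sOne (H : IsAxisSeq h a L M) (h2 : (2 : F) ≠ 0) (h0 : h ≠ 0) (h1 : 2 * h ≠ 1)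
    (h4 : 4 * h ≠ 1) (i : ℤ) {c A B C D K c' A' B' C' D' K' l m l2 m2 : F}
    (hl : L i = l) (hm : L (i + 1) = m) (hl2 : M i = l2) (hm2 : M (i + 1) = m2)
    (hc : IsCoeff h l m l2 c A B C D K) (hc' : IsCoeff h m l m2 c' A' B' C' D' K') {r : V}
    (hr : a i * a (i + 3) = r + (2 * h) • (a i + a (i + 3)))
    {N1 Ne Ns : F} (hN1 : N1 = 1 + K' + 3 * h - 8 * l * h)
    (hNe : Ne = 2 * h * D' - 16 * l * h + 4 * l * l) (hNs : Ns = 2 * D' - 8 * l) :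
    (4 : F) • (sOne h a * sOne h a) =
      (8 * c * ((1 - 4 * h) * l + 2 * h * (2 * h - 1)) - 4 * c * c + 4 * h * h * Ne
        - 2 * h * (4 * h * N1 + 2 * h * D' * K + 4 * h * h * D' + Ne
          + ((1 - 4 * h) * l + 2 * h * (2 * h - 1)) * Ns - 4 * h * h)
        - 2 * (A + 2 * l * B + c * C - 4 * h * h * l2)) • a i
      + (16 * c * h * h - 4 * h ^ 3 * D * D' - 4 * h ^ 3 * Ns) • (a (i + 1) + a (i - 1))
      + (4 * h ^ 3 * D') • (a (i + 2) + a (i - 2))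
      + (16 * h * c - 4 * h * N1 - 4 * h * h * D * D') • sOne h a
      + (4 * h * h) • r := by
  subst hl hm hl2 hm2
  obtain ⟨k, hk⟩ := H.refl_three i
  obtain ⟨e2, hsq⟩ := H.mul_second h2 h0 h1 h4 i hc
  refine axis_sq_s (H.axis i).idem (H.mul_succ i) (H.mul_pred i) (H.axis _).idem (H.axis _).idem
    (H.mul_sOne i) e2 (H.mul_neg_second h2 h0 h1 h4 i hc) hr
    (hk.axis_mul_swap (H.axis i).idem hr) ?_ hsq hN1 hNe hNs
  have hp := H.period (i - 1)
  have hp' := H.period' (i - 1)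
  rw [show i - 1 + 2 = i + 1 by ring] at hp hp'
  have f1 := H.mul_neg_second h2 h0 h1 h4 (i + 1) (c := c') (A := A') (B := B') (C := C')
    (D := D') (K := K') (by rwa [show i + 1 + 1 = i + 2 by ring, H.period])
  have f2 := (H.mul_second h2 h0 h1 h4 (i - 1) (c := c') (A := A') (B := B') (C := C')
    (D := D') (K := K') (by rwa [← hp, ← hp', show i - 1 + 1 = i by ring])).1
  rw [show i + 1 - 2 = i - 1 by ring, show i + 1 + 1 = i + 2 by ring, show i + 1 + 2 = i + 3 by ring,
    show i + 1 - 1 = i by ring] at f1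
  rw [show i - 1 + 2 = i + 1 by ring, show i - 1 + 1 = i by ring, show i - 1 - 1 = i - 2 by ring,
    show i - 1 - 2 = i - 3 by ring, mul_comm] at f2
  linear_combination (norm := module) f1 + f2

/-- Comparing the values of `s ^ 2` obtained at `a 0` and `a 3` gives a linear relation. -/
theorem relation (H : IsAxisSeq h a L M) (h2 : (2 : F) ≠ 0) (h0 : h ≠ 0) (h1 : 2 * h ≠ 1)
    (h4 : 4 * h ≠ 1) {c A B C D K c' A' B' C' D' K' l m l2 m2 : F}
    (hl : L 0 = l) (hm : L 1 = m) (hl2 : M 0 = l2) (hm2 : M 1 = m2)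
    (hc : IsCoeff h l m l2 c A B C D K) (hc' : IsCoeff h m l m2 c' A' B' C' D' K')
    {N1 Ne Ns N1' Ne' Ns' T T' M₁ : F} (hN1 : N1 = 1 + K' + 3 * h - 8 * l * h)
    (hNe : Ne = 2 * h * D' - 16 * l * h + 4 * l * l) (hNs : Ns = 2 * D' - 8 * l)
    (hN1' : N1' = 1 + K + 3 * h - 8 * m * h)
    (hNe' : Ne' = 2 * h * D - 16 * m * h + 4 * m * m) (hNs' : Ns' = 2 * D - 8 * m)
    (hT : T = 8 * c * ((1 - 4 * h) * l + 2 * h * (2 * h - 1)) - 4 * c * c + 4 * h * h * Ne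
        - 2 * h * (4 * h * N1 + 2 * h * D' * K + 4 * h * h * D' + Ne
          + ((1 - 4 * h) * l + 2 * h * (2 * h - 1)) * Ns - 4 * h * h)
        - 2 * (A + 2 * l * B + c * C - 4 * h * h * l2))
    (hT' : T' = 8 * c' * ((1 - 4 * h) * m + 2 * h * (2 * h - 1)) - 4 * c' * c' + 4 * h * h * Ne'
        - 2 * h * (4 * h * N1' + 2 * h * D * K' + 4 * h * h * D + Ne'
          + ((1 - 4 * h) * m + 2 * h * (2 * h - 1)) * Ns' - 4 * h * h)
        - 2 * (A' + 2 * m * B' + c' * C' - 4 * h * h * m2))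
    (hM : M₁ = 16 * c' * h - 4 * h * h * Ns') :
    (4 * h ^ 3 * D' - h * M₁) • a (-2)
      + (16 * c * h * h - 4 * h ^ 3 * D * D' - 4 * h ^ 3 * Ns + M₁ * h * D
          - 4 * h ^ 3 * D) • a (-1)
      + (T + M₁ * (K + h) + 4 * h ^ 3 * D * D') • a 0
      + (16 * c * h * h - 4 * h ^ 3 * D * D' - 4 * h ^ 3 * Ns - 4 * h ^ 3 * D
          + 4 * h ^ 2 * D * (K' + h)) • a 1
      + (4 * h ^ 3 * D' - (16 * c' * h * h - 4 * h ^ 3 * D * D' - 4 * h ^ 3 * Ns')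
          - M₁ * (K + h)) • a 2
      + (-T' - M₁ * h * D - 4 * h ^ 2 * D * (K' + h)) • a 3
      + (16 * h * (c - c') - 4 * h * (N1 - N1')) • sOne h a = 0 := by
  have mod2 (f : ℤ → F) (hf : ∀ i, f (i + 2) = f i) : f 3 = f 1 ∧ f (3 + 1) = f 0 :=
    ⟨by simpa using hf 1, by simpa using (hf 2).trans (by simpa using hf 0)⟩
  obtain ⟨hL3, hL4⟩ := mod2 L H.period
  obtain ⟨hM3, hM4⟩ := mod2 M H.period'
  have q0 := H.sq_sOne h2 h0 h1 h4 0 (r := a 0 * a 3 - (2 * h) • (a 0 + a 3)) hl hm hl2 hm2 hc hc'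
    (by rw [zero_add, sub_add_cancel]) hN1 hNe hNs
  obtain ⟨k, hk⟩ := H.refl_three 3
  have hr := hk.symm.axis_mul_swap (H.axis 3).idem (s := a 0 * a 3 - (2 * h) • (a 0 + a 3))
    (by rw [sub_self, mul_comm (a 3)]; module)
  have q3 := H.sq_sOne h2 h0 h1 h4 3 (hL3.trans hm) (hL4.trans hl) (hM3.trans hm2)
    (hM4.trans hl2) hc' hc hr hN1' hNe' hNs'
  have e4 := H.recurrence h2 h0 h1 h4 0 (c := c) (A := A) (B := B) (C := C) (D := D) (K := K)
    (by rwa [zero_add, hl, hm, hl2])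
  have e5 := H.recurrence h2 h0 h1 h4 1 (c := c') (A := A') (B := B') (C := C') (D := D')
    (K := K') (by rwa [show (1 + 1 : ℤ) = 0 + 2 by norm_num, H.period, hl, hm, hm2])
  norm_num at q0 q3 e4 e5
  rw [← hT] at q0
  rw [← hT'] at q3
  subst hM
  linear_combination (norm := module) q3 - q0
    - (16 * c' * h - 4 * h * h * Ns') • e4 - (4 * h ^ 2 * D) • e5

/-- If `a (-2), …, a 3` and `s` are linearly independent then the parameters agree. -/
theorem eq_of_linearIndependent (H : IsAxisSeq h a L M) (h2 : (2 : F) ≠ 0) (h0 : h ≠ 0)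
    (h1 : 2 * h ≠ 1) (h4 : 4 * h ≠ 1)
    (hli : LinearIndependent F ![a (-2), a (-1), a 0, a 1, a 2, a 3, sOne h a]) :
    L 0 = L 1 ∧ M 0 = M 1 := by
  have hzero {x₁ x₂ x₃ x₄ x₅ x₆ x₇ : F} (hx : x₁ • a (-2) + x₂ • a (-1) + x₃ • a 0 + x₄ • a 1
      + x₅ • a 2 + x₆ • a 3 + x₇ • sOne h a = 0) : x₁ = 0 ∧ x₃ = 0 ∧ x₆ = 0 ∧ x₇ = 0 := by
    have := Fintype.linearIndependent_iff.1 hli ![x₁, x₂, x₃, x₄, x₅, x₆, x₇] (by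
      rw [← hx]
      simp [Fin.sum_univ_succ]
      abel)
    exact ⟨this 0, this 2, this 5, this 6⟩
  obtain ⟨c, A, B, C, D, K, hc⟩ := exists_isCoeff h2 h0 (L 0) (L 1) (M 0)
  obtain ⟨c', A', B', C', D', K', hc'⟩ := exists_isCoeff h2 h0 (L 1) (L 0) (M 1)
  obtain ⟨k1, k3, k4, k5⟩ := hzero
    (H.relation h2 h0 h1 h4 rfl rfl rfl rfl hc hc' rfl rfl rfl rfl rfl rfl rfl rfl rfl)
  have hf := H.flip.relation h2 h0 h1 h4 (by rw [sub_zero]) (by rw [sub_self]) (by rw [sub_zero])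
    (by rw [sub_self]) hc' hc rfl rfl rfl rfl rfl rfl rfl rfl rfl
  have hs : sOne h (fun i => a (1 - i)) = sOne h a := by
    simp only [sOne, sub_zero, sub_self, mul_comm (a 1), add_comm (a 1)]
  simp only [hs] at hf
  norm_num only at hf
  obtain ⟨-, -, k2, -⟩ := hzero (Eq.trans (by abel) hf)
  exact hc.eq_and_eq h2 h0 h1 h4 hc' rfl rfl rfl rfl rfl rfl rfl rfl rfl rfl k1 k2 k3 k4 k5

end IsAxisSeq

theorem IsAxis.exists_eq {β : F} {e : V} (ha : IsAxis F (2 * β) β e) (x : V) :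
    ∃ (k : F) (u v w : V), e * u = 0 ∧ e * v = (2 * β) • v ∧ e * w = β • w ∧
      x = k • e + u + v + w := by
  have hx : x ∈ eigSp F e 1 ⊔ eigSp F e 0 ⊔ eigSp F e (2 * β) ⊔ eigSp F e β := by
    rw [ha.semisimple]; trivial
  rw [ha.primitive] at hx
  simp only [Submodule.mem_sup, mem_eigSp, zero_smul, Submodule.mem_span_singleton] at hx
  obtain ⟨_, ⟨_, ⟨_, ⟨k, rfl⟩, u, hu, rfl⟩, v, hv, rfl⟩, w, hw, rfl⟩ := hx
  exact ⟨k, u, v, w, hu, hv, hw, rfl⟩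

namespace IsMiyamoto

variable {β : F} {e : V} {τ : V ≃ₗ[F] V}

theorem apply_eq (ht : IsMiyamoto F (2 * β) β e τ) (he : e * e = e) (k : F) {u v w : V}
    (hu : e * u = 0) (hv : e * v = (2 * β) • v) (hw : e * w = β • w) :
    τ (k • e + u + v + w) = k • e + u + v - w := by
  obtain ⟨t1, t0, ta, tb⟩ := ht
  rw [map_add, map_add, map_add, map_smul, t1 e (by simpa [mem_eigSp] using he),
    t0 u (by simpa [mem_eigSp] using hu), ta v hv, tb w hw, sub_eq_add_neg]

theorem isReflected (ht : IsMiyamoto F (2 * β) β e τ) (he : e * e = e) {y : V} {l : F}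
    (hy : y - l • e ∈ complSp β e) : IsReflected β e y (τ y) l := by
  obtain ⟨u, v, w, hu, hv, hw, hx⟩ := mem_complSp.1 hy
  obtain rfl : y = l • e + u + v + w := by
    rw [← sub_add_cancel y (l • e), hx]; abel
  exact ⟨u, v, w, hu, hv, hw, rfl, ht.apply_eq he l hu hv hw⟩

theorem exists_isReflected (ht : IsMiyamoto F (2 * β) β e τ) (ha : IsAxis F (2 * β) β e) (y : V) :
    ∃ l, IsReflected β e y (τ y) l := by
  obtain ⟨k, u, v, w, hu, hv, hw, rfl⟩ := ha.exists_eq y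
  exact ⟨k, u, v, w, hu, hv, hw, rfl, ht.apply_eq ha.idem k hu hv hw⟩

theorem apply_apply (ht : IsMiyamoto F (2 * β) β e τ) (ha : IsAxis F (2 * β) β e) (y : V) :
    τ (τ y) = y := by
  obtain ⟨k, u, v, w, hu, hv, hw, rfl⟩ := ha.exists_eq y
  have hw' : e * -w = β • -w := by rw [mul_neg, hw, smul_neg]
  rw [ht.apply_eq ha.idem k hu hv hw, sub_eq_add_neg, ht.apply_eq ha.idem k hu hv hw',
    sub_neg_eq_add]

theorem apply_self (ht : IsMiyamoto F (2 * β) β e τ) (he : e * e = e) : τ e = e :=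
  ht.1 e (by simpa [mem_eigSp] using he)

theorem map_mul (ht : IsMiyamoto F (2 * β) β e τ) (ha : IsAxis F (2 * β) β e) (x y : V) :
    τ (x * y) = τ x * τ y := by
  obtain ⟨k, u, v, w, hu, hv, hw, rfl⟩ := ha.exists_eq x
  obtain ⟨k', u', v', w', hu', hv', hw', rfl⟩ := ha.exists_eq y
  rw [ht.apply_eq ha.idem k hu hv hw, ht.apply_eq ha.idem k' hu' hv' hw']
  obtain ⟨t1, t0, ta, tb⟩ := ht
  have mem0 {z : V} (hz : e * z = 0) : z ∈ eigSp F e (0 : F) := by simpa [mem_eigSp] using hz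
  have he : τ e = e := t1 e (by simpa [mem_eigSp] using ha.idem)
  have le10 : eigSp F e 1 ⊔ eigSp F e 0 ≤ LinearMap.eqLocus (τ : V →ₗ[F] V) LinearMap.id :=
    sup_le t1 t0
  have le3 : eigSp F e 1 ⊔ eigSp F e 0 ⊔ eigSp F e (2 * β) ≤
      LinearMap.eqLocus (τ : V →ₗ[F] V) LinearMap.id := sup_le le10 ta
  have f00 : τ (u * u') = u * u' := t0 _ (ha.fusion00 _ (mem0 hu) _ (mem0 hu'))
  have f0a : τ (u * v') = u * v' := ta _ (ha.fusion0a _ (mem0 hu) _ hv')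
  have fa0 : τ (v * u') = v * u' := mul_comm u' v ▸ ta _ (ha.fusion0a _ (mem0 hu') _ hv)
  have f0b : τ (u * w') = -(u * w') := tb _ (ha.fusion0b _ (mem0 hu) _ hw')
  have fb0 : τ (w * u') = -(w * u') := mul_comm u' w ▸ tb _ (ha.fusion0b _ (mem0 hu') _ hw)
  have faa : τ (v * v') = v * v' := le10 (ha.fusionaa _ hv _ hv')
  have fab : τ (v * w') = -(v * w') := tb _ (ha.fusionab _ hv _ hw')
  have fba : τ (w * v') = -(w * v') := mul_comm v' w ▸ tb _ (ha.fusionab _ hv' _ hw)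
  have fbb : τ (w * w') = w * w' := le3 (ha.fusionbb _ hw _ hw')
  simp only [mul_add, add_mul, mul_sub, sub_mul, mul_smul_comm, smul_mul_assoc, mul_comm _ e,
    ha.idem, hu, hv, hw, hu', hv', hw', map_add, map_smul, map_zero, he, ta _ hv, ta _ hv',
    tb _ hw, tb _ hw', f00, f0a, fa0, f0b, fb0, faa, fab, fba, fbb]
  module

end IsMiyamoto

omit [SMulCommClass F V V] [IsScalarTower F V V] in
theorem IsReflected.map {β : F} {e y y' : V} {l : F} (hr : IsReflected β e y y' l)
    (g : V ≃ₗ[F] V) (hg : ∀ x y, g (x * y) = g x * g y) :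
    IsReflected β (g e) (g y) (g y') l := by
  obtain ⟨u, v, w, hu, hv, hw, rfl, rfl⟩ := hr
  refine ⟨g u, g v, g w, ?_, ?_, ?_, by simp, by simp⟩
  · rw [← hg, hu, map_zero]
  · rw [← hg, hv, map_smul]
  · rw [← hg, hw, map_smul]

theorem eigSp_map (g : V ≃ₗ[F] V) (hg : ∀ x y, g (x * y) = g x * g y) (e : V) (δ : F) :
    eigSp F (g e) δ = (eigSp F e δ).map (g : V →ₗ[F] V) := by
  ext v
  obtain ⟨v, rfl⟩ := g.surjective v
  simp [mem_eigSp, ← hg, ← map_smul]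

theorem IsAxis.map {α β : F} {e : V} (ha : IsAxis F α β e) (g : V ≃ₗ[F] V)
    (hg : ∀ x y, g (x * y) = g x * g y) : IsAxis F α β (g e) := by
  have mul_mem {S T U : Submodule F V} (hf : ∀ u ∈ S, ∀ v ∈ T, u * v ∈ U) :
      ∀ u ∈ S.map (g : V →ₗ[F] V), ∀ v ∈ T.map (g : V →ₗ[F] V),
        u * v ∈ U.map (g : V →ₗ[F] V) := by
    rintro _ ⟨u, hu, rfl⟩ _ ⟨v, hv, rfl⟩
    exact ⟨u * v, hf u hu v hv, hg u v⟩
  constructor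
  · rw [← hg, ha.idem]
  all_goals simp only [eigSp_map g hg, ← Submodule.map_sup]
  · rw [ha.semisimple, Submodule.map_top]
    exact LinearMap.range_eq_top.2 g.surjective
  · rw [ha.primitive, Submodule.map_span, Set.image_singleton]
    rfl
  · exact mul_mem ha.fusion11
  · rintro _ ⟨u, hu, rfl⟩ _ ⟨v, hv, rfl⟩
    exact (hg u v).symm.trans (by rw [ha.fusion10 u hu v hv, map_zero])
  · exact mul_mem ha.fusion1a
  · exact mul_mem ha.fusion1b
  · exact mul_mem ha.fusion00
  · exact mul_mem ha.fusion0a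
  · exact mul_mem ha.fusion0b
  · exact mul_mem ha.fusionaa
  · exact mul_mem ha.fusionab
  · exact mul_mem ha.fusionbb

theorem aSeq_zero (a₀ a₁ : V) (τ₀ τ₁ : V ≃ₗ[F] V) : aSeq a₀ a₁ τ₀ τ₁ 0 = a₀ := by
  simp [aSeq]

theorem aSeq_one (a₀ a₁ : V) (τ₀ τ₁ : V ≃ₗ[F] V) : aSeq a₀ a₁ τ₀ τ₁ 1 = a₁ := by
  simp [aSeq]

theorem aSeq_add_two (a₀ a₁ : V) (τ₀ τ₁ : V ≃ₗ[F] V) (i : ℤ) :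
    aSeq a₀ a₁ τ₀ τ₁ (i + 2) = τ₁ (τ₀ (aSeq a₀ a₁ τ₀ τ₁ i)) := by
  have e1 : (i + 2) / 2 = 1 + i / 2 := by lia
  have e2 : (i + 2 - 1) / 2 = 1 + (i - 1) / 2 := by lia
  simp only [aSeq, Int.add_emod_right, e1, e2, zpow_add, zpow_one]
  split_ifs <;> rfl

theorem forall_of_step {P : ℤ → Prop} (p0 : P 0) (p1 : P 1) (hs : ∀ i, P i → P (i + 2))
    (hp : ∀ i, P (i + 2) → P i) (i : ℤ) : P i := by
  suffices hi : P i ∧ P (i + 1) from hi.1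
  induction i using Int.induction_on with
  | zero => exact ⟨p0, by simpa using p1⟩
  | succ j ih => exact ⟨ih.2, by simpa [add_assoc] using hs _ ih.1⟩
  | pred j ih =>
    refine ⟨hp _ ?_, by simpa using ih.1⟩
    convert ih.2 using 1
    ring

/-- The axes generated by `a₀` and `a₁` form an `IsAxisSeq`. -/
theorem isAxisSeq_aSeq {h : F} {a₀ a₁ : V} (ha₀ : IsAxis F (2 * (2 * h)) (2 * h) a₀)
    (ha₁ : IsAxis F (2 * (2 * h)) (2 * h) a₁) {τ₀ τ₁ : V ≃ₗ[F] V}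
    (hτ₀ : IsMiyamoto F (2 * (2 * h)) (2 * h) a₀ τ₀)
    (hτ₁ : IsMiyamoto F (2 * (2 * h)) (2 * h) a₁ τ₁) {l1 l1f l2 l2f : F}
    (hl1 : aSeq a₀ a₁ τ₀ τ₁ 1 - l1 • a₀ ∈ complSp (2 * h) a₀)
    (hl1f : aSeq a₀ a₁ τ₀ τ₁ 0 - l1f • a₁ ∈ complSp (2 * h) a₁)
    (hl2 : aSeq a₀ a₁ τ₀ τ₁ 2 - l2 • a₀ ∈ complSp (2 * h) a₀)
    (hl2f : aSeq a₀ a₁ τ₀ τ₁ (-1) - l2f • a₁ ∈ complSp (2 * h) a₁) :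
    IsAxisSeq h (aSeq a₀ a₁ τ₀ τ₁) (fun i => if i % 2 = 0 then l1 else l1f)
      (fun i => if i % 2 = 0 then l2 else l2f) := by
  have hz := aSeq_zero a₀ a₁ τ₀ τ₁
  have ho := aSeq_one a₀ a₁ τ₀ τ₁
  have hstep := aSeq_add_two a₀ a₁ τ₀ τ₁
  set a := aSeq a₀ a₁ τ₀ τ₁
  have i0 := hτ₀.apply_apply ha₀
  have i1 := hτ₁.apply_apply ha₁
  have hback (i : ℤ) : τ₀ (τ₁ (a (i + 2))) = a i := by rw [hstep, i1, i0]
  have m1 : τ₀ (a 1) = a (-1) := by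
    rw [← hback (-1), show (-1 + 2 : ℤ) = 1 by norm_num, ho, hτ₁.apply_self ha₁.idem]
  have n1 : τ₁ (a 0) = a 2 := by
    rw [← zero_add (2 : ℤ), hstep, hz, hτ₀.apply_self ha₀.idem]
  have m2 : τ₀ (a 2) = a (-2) := by rw [← hback (-2), ← n1]; norm_num
  have n2 : τ₁ (a (-1)) = a 3 := by rw [← m1, ← hstep]; norm_num
  have m3 : τ₀ (a 3) = a (-3) := by rw [← hback (-3), ← n2]; norm_num
  have n3 : τ₁ (a (-2)) = a 4 := by rw [← m2, ← hstep]; norm_num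
  have hg (x y : V) : (τ₀.trans τ₁) (x * y) = (τ₀.trans τ₁) x * (τ₀.trans τ₁) y := by
    simp only [LinearEquiv.trans_apply, hτ₀.map_mul ha₀, hτ₁.map_mul ha₁]
  have hg' (x y : V) : (τ₁.trans τ₀) (x * y) = (τ₁.trans τ₀) x * (τ₁.trans τ₀) y := by
    simp only [LinearEquiv.trans_apply, hτ₀.map_mul ha₀, hτ₁.map_mul ha₁]
  have refl {n : ℤ} {l l' : F} (r0 : IsReflected (2 * h) (a 0) (a n) (a (-n)) l)
      (r1 : IsReflected (2 * h) (a 1) (a (1 + n)) (a (1 - n)) l') (i : ℤ) :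
      IsReflected (2 * h) (a i) (a (i + n)) (a (i - n)) (if i % 2 = 0 then l else l') := by
    refine forall_of_step (P := fun i => IsReflected (2 * h) (a i) (a (i + n)) (a (i - n))
      (if i % 2 = 0 then l else l')) (by simpa using r0) (by simpa using r1) ?_ ?_ i
    · intro i hi
      have := hi.map _ hg
      simp only [LinearEquiv.trans_apply, ← hstep] at this
      simpa only [Int.add_emod_right, add_right_comm i, add_sub_right_comm i] using this
    · intro i hi
      simp only [Int.add_emod_right, add_right_comm i, add_sub_right_comm i] at hi
      simpa only [LinearEquiv.trans_apply, hback] using hi.map _ hg'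
  refine ⟨forall_of_step (by rwa [hz]) (by rwa [ho]) ?_ ?_, refl ?_ ?_, refl ?_ ?_, ?_, ?_, ?_⟩
  · intro i hi
    rw [hstep]
    exact hi.map _ hg
  · intro i hi
    rw [← hback]
    exact hi.map _ hg'
  · rw [← m1, hz]
    exact hτ₀.isReflected ha₀.idem hl1
  · norm_num
    rw [← n1, ho]
    exact (hτ₁.isReflected ha₁.idem hl1f).symm
  · rw [← m2, hz]
    exact hτ₀.isReflected ha₀.idem hl2
  · norm_num
    rw [← n2, ho]
    exact (hτ₁.isReflected ha₁.idem hl2f).symm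
  · obtain ⟨l, hl⟩ := hτ₀.exists_isReflected ha₀ (a 3)
    obtain ⟨l', hl'⟩ := hτ₁.exists_isReflected ha₁ (a (-2))
    rw [m3, ← hz] at hl
    rw [n3, ← ho] at hl'
    exact fun i => ⟨_, refl hl (by norm_num; exact hl'.symm) i⟩
  · intro i; simp
  · intro i; simp

end MonsterType

/-- If the eight elements `a₋₂, a₋₁, a₀, a₁, a₂, a₃, s₀,₁, s₀,₃` are linearly
independent then `λ₁ = λ₁ᶠ` and `λ₂ = λ₂ᶠ`. -/
theorem stmt3 (F : Type*) [Field F] (V : Type*) [NonUnitalNonAssocCommRing V]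
    [Module F V] [SMulCommClass F V V] [IsScalarTower F V V]
    (β : F) (hchar : (2 : F) ≠ 0) (hβ0 : β ≠ 0) (hβ1 : β ≠ 1) (hβhalf : β ≠ 1 / 2)
    (a₀ a₁ : V) (ha₀ : IsAxis F (2 * β) β a₀) (ha₁ : IsAxis F (2 * β) β a₁)
    (hgen : NonUnitalAlgebra.adjoin F {a₀, a₁} = ⊤)
    (τ₀ τ₁ : V ≃ₗ[F] V)
    (hτ₀ : IsMiyamoto F (2 * β) β a₀ τ₀) (hτ₁ : IsMiyamoto F (2 * β) β a₁ τ₁)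
    (l1 l1f l2 l2f : F)
    (hl1 : aSeq a₀ a₁ τ₀ τ₁ 1 - l1 • a₀ ∈
      eigSp F a₀ 0 ⊔ eigSp F a₀ (2 * β) ⊔ eigSp F a₀ β)
    (hl1f : aSeq a₀ a₁ τ₀ τ₁ 0 - l1f • a₁ ∈
      eigSp F a₁ 0 ⊔ eigSp F a₁ (2 * β) ⊔ eigSp F a₁ β)
    (hl2 : aSeq a₀ a₁ τ₀ τ₁ 2 - l2 • a₀ ∈
      eigSp F a₀ 0 ⊔ eigSp F a₀ (2 * β) ⊔ eigSp F a₀ β)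
    (hl2f : aSeq a₀ a₁ τ₀ τ₁ (-1) - l2f • a₁ ∈
      eigSp F a₁ 0 ⊔ eigSp F a₁ (2 * β) ⊔ eigSp F a₁ β)
    (hli : LinearIndependent F
      ![aSeq a₀ a₁ τ₀ τ₁ (-2), aSeq a₀ a₁ τ₀ τ₁ (-1), aSeq a₀ a₁ τ₀ τ₁ 0, aSeq a₀ a₁ τ₀ τ₁ 1,
        aSeq a₀ a₁ τ₀ τ₁ 2, aSeq a₀ a₁ τ₀ τ₁ 3, sSeq β a₀ a₁ τ₀ τ₁ 0 1, sSeq β a₀ a₁ τ₀ τ₁ 0 3]) :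
    l1 = l1f ∧ l2 = l2f := by
  obtain ⟨h, rfl⟩ : ∃ h : F, β = 2 * h := ⟨β / 2, (mul_div_cancel₀ β hchar).symm⟩
  have H := isAxisSeq_aSeq ha₀ ha₁ hτ₀ hτ₁ hl1 hl1f hl2 hl2f
  have h4 : 4 * h ≠ 1 := by
    rintro h4
    refine hβhalf ?_
    rw [eq_div_iff hchar]
    linear_combination h4
  have := H.eq_of_linearIndependent hchar (right_ne_zero_of_mul hβ0) hβ1 h4 (by
    have := hli.comp (Fin.castSucc : Fin 7 → Fin 8) (Fin.castSucc_injective 7)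
    convert this using 1
    ext i
    fin_cases i <;> rfl)
  simpa using this
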